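/- arXiv:2501.02827 — 2 statements merged into one kernel-verified Lean document; each statement's English description precedes it below -/
import Mathlib

section
/- Let N ≥ 1, s ∈ (0,1], q₀ > N, and let f(x) = ⟨x⟩^{−q₀} = (1 + |x|²)^{−q₀/2}. Then f ∈ L^∞(ℝ^N) ∩ C^∞(ℝ^N), all second-order partial derivatives of f are bounded on ℝ^N, and there exists a constant C > 0 such that |(−Δ)^s f(x)| ≤ C (1 + |x|²)^{−(N + 2s)/2} for all x ∈ ℝ^N. -/
open MeasureTheory Filter
open scoped ENNReal

noncomputable section

/-- The partial derivative `∂ᵢ f`. -/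
def pderiv' (N : ℕ) (i : Fin N) (f : EuclideanSpace ℝ (Fin N) → ℝ)
    (x : EuclideanSpace ℝ (Fin N)) : ℝ :=
  fderiv ℝ f x (EuclideanSpace.single i 1)

/-- The classical Laplacian `Δf = ∑ᵢ ∂ᵢ² f`. -/
def laplacian (N : ℕ) (f : EuclideanSpace ℝ (Fin N) → ℝ)
    (x : EuclideanSpace ℝ (Fin N)) : ℝ :=
  ∑ i : Fin N, pderiv' N i (fun y => pderiv' N i f y) x

/-- The normalizing constant `C_{N,s} = s 4^s Γ(N/2+s) / (π^{N/2} Γ(1-s))`. -/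
def fracLapConst (N : ℕ) (s : ℝ) : ℝ :=
  s * 4 ^ s * Real.Gamma ((N : ℝ) / 2 + s) / (Real.pi ^ ((N : ℝ) / 2) * Real.Gamma (1 - s))

/-- The fractional Laplacian `(-Δ)^s f(x)` as a principal-value integral. -/
def fracLap (N : ℕ) (s : ℝ) (f : EuclideanSpace ℝ (Fin N) → ℝ)
    (x : EuclideanSpace ℝ (Fin N)) : ℝ :=
  fracLapConst N s *
    limUnder (nhdsWithin (0 : ℝ) (Set.Ioi 0)) (fun ε : ℝ =>
      ∫ y in {y : EuclideanSpace ℝ (Fin N) | ε < ‖x - y‖},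
        (f x - f y) / ‖x - y‖ ^ ((N : ℝ) + 2 * s))

/-- `(-Δ)^s` for `s ∈ (0,1]`: the p.v. integral for `s < 1`, and `-Δ` for `s = 1`. -/
def fracLapGen (N : ℕ) (s : ℝ) (f : EuclideanSpace ℝ (Fin N) → ℝ)
    (x : EuclideanSpace ℝ (Fin N)) : ℝ :=
  if s = 1 then -laplacian N f x else fracLap N s f x

/-- The mixed local-nonlocal operator `ℒ = -Δ + (-Δ)^{α/2}`. -/
def mixedOp (N : ℕ) (α : ℝ) (f : EuclideanSpace ℝ (Fin N) → ℝ)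
    (x : EuclideanSpace ℝ (Fin N)) : ℝ :=
  -laplacian N f x + fracLap N (α / 2) f x

section Calculus

variable {E : Type*} [NormedAddCommGroup E] [InnerProductSpace ℝ E]

lemma contDiff_one_add_norm_sq_rpow (b : ℝ) {n : WithTop ℕ∞} :
    ContDiff ℝ n fun x : E => (1 + ‖x‖ ^ 2 : ℝ) ^ b :=
  (contDiff_const.add (contDiff_norm_sq ℝ)).rpow_const_of_ne fun x => by positivity

lemma hasFDerivAt_one_add_norm_sq_rpow (b : ℝ) (x : E) :
    HasFDerivAt (fun x : E => (1 + ‖x‖ ^ 2 : ℝ) ^ b)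
      ((b * (1 + ‖x‖ ^ 2) ^ (b - 1)) • ((2 : ℕ) • innerSL ℝ x)) x :=
  ((hasStrictFDerivAt_norm_sq x).hasFDerivAt.const_add 1).rpow_const
    (.inl (by positivity))

lemma fderiv_one_add_norm_sq_rpow (b : ℝ) :
    fderiv ℝ (fun x : E => (1 + ‖x‖ ^ 2 : ℝ) ^ b) =
      fun x => (1 + ‖x‖ ^ 2 : ℝ) ^ (b - 1) • (2 * b) • innerSL ℝ x := by
  ext1 x
  rw [(hasFDerivAt_one_add_norm_sq_rpow b x).fderiv]
  ext v
  simp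
  ring

lemma norm_fderiv_fderiv_one_add_norm_sq_rpow_le (b : ℝ) (x : E) :
    ‖fderiv ℝ (fderiv ℝ fun x : E => (1 + ‖x‖ ^ 2 : ℝ) ^ b) x‖ ≤
      (2 * |b| + 4 * |b - 1| * |b|) * (1 + ‖x‖ ^ 2) ^ (b - 1) := by
  obtain ⟨L, hL, hLn⟩ : ∃ L : E →L[ℝ] E →L[ℝ] ℝ, (∀ x, innerSL ℝ x = L x) ∧ ‖L‖ ≤ 1 :=
    ⟨innerSL ℝ, fun _ => rfl, norm_innerSL_le ℝ⟩
  have hLx : ‖L x‖ = ‖x‖ := by rw [← hL, innerSL_apply_norm]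
  have h : HasFDerivAt (fun x : E => (1 + ‖x‖ ^ 2 : ℝ) ^ (b - 1) • (2 * b) • L x)
      ((1 + ‖x‖ ^ 2) ^ (b - 1) • (2 * b) • L +
        (((b - 1) * (1 + ‖x‖ ^ 2) ^ (b - 1 - 1)) • (2 : ℕ) • L x).smulRight (((2 * b) • L) x)) x :=
    hL x ▸ (hasFDerivAt_one_add_norm_sq_rpow (b - 1) x).smul ((2 * b) • L).hasFDerivAt
  rw [fderiv_one_add_norm_sq_rpow]
  simp only [hL]
  have hw : 0 < 1 + ‖x‖ ^ 2 := by positivity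
  have hwb : (1 + ‖x‖ ^ 2) ^ (b - 1) = (1 + ‖x‖ ^ 2) ^ (b - 1 - 1) * (1 + ‖x‖ ^ 2) := by
    rw [← Real.rpow_add_one hw.ne']; ring_nf
  have hp : 0 < (1 + ‖x‖ ^ 2) ^ (b - 1 - 1) := Real.rpow_pos_of_pos hw _
  rw [h.fderiv]
  refine (norm_add_le (E := E →L[ℝ] E →L[ℝ] ℝ) _ _).trans ?_
  refine (add_le_add (ContinuousLinearMap.opNorm_smul_le _ _)
    (ContinuousLinearMap.norm_smulRight_apply _ _).le).trans ?_
  have h1 : ‖(2 * b) • L‖ ≤ 2 * |b| := by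
    refine (L.opNorm_smul_le _).trans ?_
    rw [Real.norm_eq_abs, abs_mul, abs_two]
    exact mul_le_of_le_one_right (by positivity) hLn
  have h2 : ‖((2 * b) • L) x‖ = 2 * |b| * ‖x‖ := by
    rw [smul_apply, norm_smul, Real.norm_eq_abs, abs_mul, abs_two, hLx]
  have h3 : ‖((b - 1) * (1 + ‖x‖ ^ 2) ^ (b - 1 - 1)) • ((2 : ℕ) • L x)‖ ≤
      |b - 1| * (1 + ‖x‖ ^ 2) ^ (b - 1 - 1) * (2 * ‖x‖) := by
    rw [norm_smul, Real.norm_eq_abs, abs_mul, abs_of_pos hp]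
    gcongr
    refine norm_nsmul_le.trans ?_
    simp [hLx]
  rw [h2, Real.norm_eq_abs, abs_of_pos (Real.rpow_pos_of_pos hw _)]
  calc _ ≤ (1 + ‖x‖ ^ 2) ^ (b - 1) * (2 * |b|) +
        |b - 1| * (1 + ‖x‖ ^ 2) ^ (b - 1 - 1) * (2 * ‖x‖) * (2 * |b| * ‖x‖) := by gcongr
    _ = (1 + ‖x‖ ^ 2) ^ (b - 1) * (2 * |b|) +
        4 * |b - 1| * |b| * ((1 + ‖x‖ ^ 2) ^ (b - 1 - 1) * ‖x‖ ^ 2) := by ring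
    _ ≤ (1 + ‖x‖ ^ 2) ^ (b - 1) * (2 * |b|) +
        4 * |b - 1| * |b| * ((1 + ‖x‖ ^ 2) ^ (b - 1 - 1) * (1 + ‖x‖ ^ 2)) := by gcongr; linarith
    _ = _ := by rw [← hwb]; ring

end Calculus

lemma one_add_norm_sq_div_four_le {E : Type*} [SeminormedAddCommGroup E] {x v : E} (hv : ‖v‖ ^ 2 ≤ (1 + ‖x‖ ^ 2) / 4) :
    (1 + ‖x‖ ^ 2) / 4 ≤ 1 + ‖x + v‖ ^ 2 := by
  have h : ‖x‖ ≤ ‖x + v‖ + ‖v‖ := by simpa using norm_sub_le (x + v) v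
  have h2 : ‖x‖ ^ 2 ≤ (‖x + v‖ + ‖v‖) ^ 2 := by gcongr
  nlinarith [sq_nonneg (‖x + v‖ - ‖v‖)]

section SecondDifference

variable {E : Type*} [NormedAddCommGroup E] [NormedSpace ℝ E]

lemma abs_second_difference_le {f : E → ℝ} (hf : ContDiff ℝ 2 f) {x z : E} {M : ℝ}
    (hM : ∀ v, ‖v‖ ≤ ‖z‖ → ‖fderiv ℝ (fderiv ℝ f) (x + v)‖ ≤ M) :
    |2 * f x - f (x + z) - f (x - z)| ≤ 2 * M * ‖z‖ ^ 2 := by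
  have hd : Differentiable ℝ f := hf.differentiable (by norm_num)
  have hd' : Differentiable ℝ (fderiv ℝ f) :=
    (hf.fderiv_right (m := 1) (by norm_num)).differentiable (by norm_num)
  have hder (v : E) : HasFDerivAt (fun v => f (x + v) + f (x - v))
      (fderiv ℝ f (x + v) - fderiv ℝ f (x - v)) v := by
    have h1 := (hd (x + v)).hasFDerivAt.comp v ((hasFDerivAt_id v).const_add x)
    have h2 := (hd (x - v)).hasFDerivAt.comp v ((hasFDerivAt_id v).const_sub x)
    convert! h1.add h2 using 1
    ext; simp [sub_eq_add_neg]
  have hbound (v : E) (hv : v ∈ Metric.closedBall (0 : E) ‖z‖) :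
      ‖fderiv ℝ f (x + v) - fderiv ℝ f (x - v)‖ ≤ 2 * M * ‖z‖ := by
    rw [mem_closedBall_zero_iff] at hv
    have hM0 : 0 ≤ M := (norm_nonneg (fderiv ℝ (fderiv ℝ f) (x + z))).trans (hM z le_rfl)
    have h := (convex_closedBall x ‖z‖).norm_image_sub_le_of_norm_fderiv_le (𝕜 := ℝ)
      (f := fderiv ℝ f) (x := x - v) (y := x + v) (C := M) (fun y _ => hd' y)
      (fun y hy => by simpa using hM (y - x) (by simpa [dist_eq_norm] using hy))
      (by simpa using hv) (by simpa using hv)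
    refine h.trans ?_
    have : ‖x + v - (x - v)‖ ≤ 2 * ‖z‖ := by
      rw [show x + v - (x - v) = v + v by abel]
      linarith [norm_add_le v v]
    nlinarith
  have h := (convex_closedBall (0 : E) ‖z‖).norm_image_sub_le_of_norm_hasFDerivWithin_le
    (𝕜 := ℝ) (x := 0) (y := z) (fun v _ => (hder v).hasFDerivWithinAt) hbound
    (by simp) (by simp)
  simp only [add_zero, sub_zero, Real.norm_eq_abs] at h
  rw [abs_sub_comm] at h
  rw [show 2 * f x - f (x + z) - f (x - z) = f x + f x - (f (x + z) + f (x - z)) by ring]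
  exact h.trans_eq (by ring)

end SecondDifference

section Kernel

variable {E : Type*} [NormedAddCommGroup E] [NormedSpace ℝ E] [FiniteDimensional ℝ E]
  [Nontrivial E] [MeasurableSpace E] [BorelSpace E]

lemma integrable_min_one_norm_sq_div_rpow (μ : Measure E) [μ.IsAddHaarMeasure] {s : ℝ}
    (hs : 0 < s) (hs1 : s < 1) :
    Integrable (fun u : E => min 1 (‖u‖ ^ 2) / ‖u‖ ^ (Module.finrank ℝ E + 2 * s)) μ := by
  rw [integrable_fun_norm_addHaar μ
    (f := fun r : ℝ => min 1 (r ^ 2) / r ^ (Module.finrank ℝ E + 2 * s))]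
  have hd : 0 < Module.finrank ℝ E := Module.finrank_pos
  have key (r : ℝ) (hr : 0 < r) : r ^ (Module.finrank ℝ E - 1) •
      (min 1 (r ^ 2) / r ^ (Module.finrank ℝ E + 2 * s)) = min 1 (r ^ 2) * r ^ (-1 - 2 * s) := by
    have : r ^ (-1 - 2 * s) =
        r ^ (Module.finrank ℝ E - 1) / r ^ (Module.finrank ℝ E + 2 * s) := by
      rw [← Real.rpow_natCast, ← Real.rpow_sub hr, Nat.cast_sub hd]
      congr 1; push_cast; ring
    rw [this, smul_eq_mul]; ring
  rw [← Set.Ioc_union_Ioi_eq_Ioi zero_le_one]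
  refine IntegrableOn.union ?_ ?_
  · have h : IntegrableOn (fun r : ℝ => r ^ (1 - 2 * s)) (Set.Ioc 0 1) :=
      (intervalIntegrable_iff_integrableOn_Ioc_of_le zero_le_one).1
        (intervalIntegral.intervalIntegrable_rpow' (by linarith))
    refine h.congr_fun (fun r hr => ?_) measurableSet_Ioc
    beta_reduce
    rw [key r hr.1, min_eq_right (pow_le_one₀ hr.1.le hr.2), ← Real.rpow_two, ← Real.rpow_add hr.1]
    ring_nf
  · have h : IntegrableOn (fun r : ℝ => r ^ (-1 - 2 * s)) (Set.Ioi 1) :=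
      integrableOn_Ioi_rpow_of_lt (by linarith) one_pos
    refine h.congr_fun (fun r hr => ?_) measurableSet_Ioi
    have hr : 1 < r := hr
    beta_reduce
    rw [key r (by linarith), min_eq_left (one_le_pow₀ hr.le), one_mul]

end Kernel

section Bracket

variable {E : Type*} [NormedAddCommGroup E] [InnerProductSpace ℝ E]

lemma exists_abs_second_difference_one_add_norm_sq_rpow_le {b : ℝ} (hb : b < 0) :
    ∃ C : ℝ, 0 ≤ C ∧ ∀ x z : E, ‖z‖ ^ 2 ≤ (1 + ‖x‖ ^ 2) / 4 →
      |2 * (1 + ‖x‖ ^ 2) ^ b - (1 + ‖x + z‖ ^ 2) ^ b - (1 + ‖x - z‖ ^ 2) ^ b| ≤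
        C * ((1 + ‖x‖ ^ 2) ^ b * (‖z‖ ^ 2 / (1 + ‖x‖ ^ 2))) := by
  refine ⟨2 * ((2 * |b| + 4 * |b - 1| * |b|) / 4 ^ (b - 1)), by positivity, fun x z hz => ?_⟩
  have hw : 0 < 1 + ‖x‖ ^ 2 := by positivity
  refine (abs_second_difference_le (f := fun x : E => (1 + ‖x‖ ^ 2 : ℝ) ^ b)
    (M := (2 * |b| + 4 * |b - 1| * |b|) * ((1 + ‖x‖ ^ 2) / 4) ^ (b - 1))
    (contDiff_one_add_norm_sq_rpow b) fun v hv => ?_).trans_eq ?_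
  · refine (norm_fderiv_fderiv_one_add_norm_sq_rpow_le b _).trans ?_
    refine mul_le_mul_of_nonneg_left ?_ (by positivity)
    refine Real.rpow_le_rpow_of_nonpos (by positivity)
      (one_add_norm_sq_div_four_le (le_trans ?_ hz)) (by linarith)
    gcongr
  · rw [Real.div_rpow hw.le (by norm_num), Real.rpow_sub_one hw.ne']
    ring

lemma exists_second_difference_div_rpow_le {b p : ℝ} (hb : b < 0) (hp : 0 ≤ p) :
    ∃ C : ℝ, 0 ≤ C ∧ ∀ x z : E,
      |(2 * (1 + ‖x‖ ^ 2) ^ b - (1 + ‖x + z‖ ^ 2) ^ b - (1 + ‖x - z‖ ^ 2) ^ b) / ‖z‖ ^ p| ≤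
        C * (1 + ‖x‖ ^ 2) ^ (b - p / 2) *
            (min 1 (‖(√(1 + ‖x‖ ^ 2))⁻¹ • z‖ ^ 2) / ‖(√(1 + ‖x‖ ^ 2))⁻¹ • z‖ ^ p) +
          2 ^ p * (1 + ‖x‖ ^ 2) ^ (-(p / 2)) *
            ((1 + ‖x + z‖ ^ 2) ^ b + (1 + ‖x - z‖ ^ 2) ^ b) := by
  obtain ⟨C, hC, h⟩ := exists_abs_second_difference_one_add_norm_sq_rpow_le (E := E) hb
  refine ⟨C + 8, by positivity, fun x z => ?_⟩
  specialize h x z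
  have hfp : 0 < (1 + ‖x + z‖ ^ 2) ^ b := by positivity
  have hfm : 0 < (1 + ‖x - z‖ ^ 2) ^ b := by positivity
  have hw : 0 < 1 + ‖x‖ ^ 2 := by positivity
  have hu : ‖(√(1 + ‖x‖ ^ 2))⁻¹ • z‖ = ‖z‖ / √(1 + ‖x‖ ^ 2) := by
    rw [norm_smul, norm_inv, Real.norm_eq_abs, abs_of_nonneg (Real.sqrt_nonneg _), inv_mul_eq_div]
  rw [hu, div_pow, Real.sq_sqrt hw.le, Real.div_rpow (norm_nonneg z) (Real.sqrt_nonneg _)]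
  have hsqrt : √(1 + ‖x‖ ^ 2) ^ p = (1 + ‖x‖ ^ 2) ^ (p / 2) := by
    rw [Real.sqrt_eq_rpow, ← Real.rpow_mul hw.le]; ring_nf
  rw [hsqrt]
  generalize 1 + ‖x‖ ^ 2 = w at *
  generalize (1 + ‖x + z‖ ^ 2) ^ b = fp at *
  generalize (1 + ‖x - z‖ ^ 2) ^ b = fm at *
  have hwb : 0 < w ^ b := Real.rpow_pos_of_pos hw _
  have hk : (C + 8) * w ^ (b - p / 2) * (min 1 (‖z‖ ^ 2 / w) / (‖z‖ ^ p / w ^ (p / 2))) =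
      (C + 8) * (w ^ b * min 1 (‖z‖ ^ 2 / w)) / ‖z‖ ^ p := by
    have := (Real.rpow_pos_of_pos hw (p / 2)).ne'
    rw [Real.rpow_sub hw, div_div_eq_mul_div]
    field_simp
  rw [hk, abs_div, abs_of_nonneg (by positivity : 0 ≤ ‖z‖ ^ p)]
  rcases le_or_gt (‖z‖ ^ 2) (w / 4) with hz | hz
  · have hle : ‖z‖ ^ 2 / w ≤ 1 := by rw [div_le_one hw]; linarith
    rw [min_eq_right hle]
    refine le_add_of_le_of_nonneg ?_ (by positivity)
    gcongr
    refine (h hz).trans ?_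
    gcongr
    linarith
  · have hmin : 1 / 4 ≤ min 1 (‖z‖ ^ 2 / w) :=
      le_min (by norm_num) (by rw [le_div_iff₀ hw]; linarith)
    have hzp : w ^ (p / 2) / 2 ^ p ≤ ‖z‖ ^ p := by
      rw [show p = 2 * (p / 2) by ring, Real.rpow_mul (by norm_num), Real.rpow_mul (norm_nonneg z),
        Real.rpow_two, Real.rpow_two, show 2 * (p / 2) / 2 = p / 2 by ring,
        ← Real.div_rpow hw.le (by norm_num)]
      exact Real.rpow_le_rpow (by positivity) (by linarith) (by positivity)
    have hwp : 0 < w ^ (p / 2) := Real.rpow_pos_of_pos hw _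
    have hzinv : (‖z‖ ^ p)⁻¹ ≤ 2 ^ p * w ^ (-(p / 2)) := by
      rw [Real.rpow_neg hw.le, ← div_eq_mul_inv, ← inv_div]
      exact inv_anti₀ (by positivity) hzp
    have hD : |2 * w ^ b - fp - fm| ≤ 2 * w ^ b + (fp + fm) := by
      rw [abs_le]; constructor <;> linarith
    calc |2 * w ^ b - fp - fm| / ‖z‖ ^ p
        ≤ (2 * w ^ b + (fp + fm)) / ‖z‖ ^ p := by gcongr
      _ = 8 * (w ^ b * (1 / 4)) / ‖z‖ ^ p + (‖z‖ ^ p)⁻¹ * (fp + fm) := by ring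
      _ ≤ _ := by
        gcongr
        linarith

end Bracket

lemma tendsto_setIntegral_lt_norm {E : Type*} [NormedAddCommGroup E] [MeasurableSpace E]
    [BorelSpace E] (μ : Measure E) {H : E → ℝ} (hH : Integrable H μ)
    (h0 : H 0 = 0) :
    Tendsto (fun ε : ℝ => ∫ z in {z | ε < ‖z‖}, H z ∂μ) (nhdsWithin 0 (Set.Ioi 0))
      (nhds (∫ z, H z ∂μ)) := by
  have hA (ε : ℝ) : MeasurableSet {z : E | ε < ‖z‖} :=
    measurableSet_lt measurable_const measurable_norm
  simp_rw [← integral_indicator (hA _)]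
  refine tendsto_integral_filter_of_dominated_convergence (fun z => ‖H z‖)
    (.of_forall fun ε => hH.1.indicator (hA ε))
    (.of_forall fun ε => .of_forall fun z => norm_indicator_le_norm_self _ _) hH.norm
    (.of_forall fun z => ?_)
  rcases eq_or_ne z 0 with rfl | hz
  · refine tendsto_const_nhds.congr fun ε => ?_
    simp [Set.indicator, h0]
  · refine tendsto_const_nhds.congr' ?_
    filter_upwards [nhdsWithin_le_nhds (Iio_mem_nhds (norm_pos_iff.2 hz))] with ε hε
    exact (Set.indicator_of_mem (s := {z : E | ε < ‖z‖}) hε H).symm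

section PrincipalValue

variable {E : Type*} [NormedAddCommGroup E] [InnerProductSpace ℝ E] [FiniteDimensional ℝ E]
  [Nontrivial E] [MeasurableSpace E] [BorelSpace E]

lemma exists_integral_abs_second_difference_le (μ : Measure E) [μ.IsAddHaarMeasure] {b s : ℝ}
    (hb : b < -(Module.finrank ℝ E / 2)) (hs : 0 < s) (hs1 : s < 1) :
    ∃ C : ℝ, ∀ x : E,
      Integrable (fun z : E =>
        (2 * (1 + ‖x‖ ^ 2) ^ b - (1 + ‖x + z‖ ^ 2) ^ b - (1 + ‖x - z‖ ^ 2) ^ b) /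
          ‖z‖ ^ (Module.finrank ℝ E + 2 * s)) μ ∧
      |∫ z : E, (2 * (1 + ‖x‖ ^ 2) ^ b - (1 + ‖x + z‖ ^ 2) ^ b - (1 + ‖x - z‖ ^ 2) ^ b) /
          ‖z‖ ^ (Module.finrank ℝ E + 2 * s) ∂μ| ≤
        C * (1 + ‖x‖ ^ 2) ^ (-((Module.finrank ℝ E + 2 * s) / 2)) := by
  have hd : 0 ≤ (Module.finrank ℝ E : ℝ) / 2 := by positivity
  obtain ⟨C, hC, h⟩ := exists_second_difference_div_rpow_le (E := E) (b := b)
    (p := Module.finrank ℝ E + 2 * s) (by linarith) (by positivity)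
  have hk := integrable_min_one_norm_sq_div_rpow μ hs hs1
  have hf : Integrable (fun x : E => (1 + ‖x‖ ^ 2 : ℝ) ^ b) μ := by
    simpa using integrable_rpow_neg_one_add_norm_sq (μ := μ) (r := -(2 * b)) (by linarith)
  set p : ℝ := Module.finrank ℝ E + 2 * s with hp
  set K := ∫ u : E, min 1 (‖u‖ ^ 2) / ‖u‖ ^ p ∂μ with hK
  set F := ∫ u : E, (1 + ‖u‖ ^ 2) ^ b ∂μ with hF
  have hK0 : 0 ≤ K := integral_nonneg fun u => by positivity
  refine ⟨C * K + 2 ^ p * (F + F), fun x => ?_⟩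
  have hw : 1 ≤ 1 + ‖x‖ ^ 2 := by nlinarith [sq_nonneg ‖x‖]
  have hw0 : 0 < 1 + ‖x‖ ^ 2 := by positivity
  have hR : 0 < √(1 + ‖x‖ ^ 2) := Real.sqrt_pos.2 hw0
  have hI1 := (hk.comp_smul (inv_ne_zero hR.ne')).const_mul (C * (1 + ‖x‖ ^ 2) ^ (b - p / 2))
  have hI2 := ((hf.comp_add_left x).add (hf.comp_sub_left x)).const_mul
    (2 ^ p * (1 + ‖x‖ ^ 2) ^ (-(p / 2)))
  have hmeas : AEStronglyMeasurable (fun z : E =>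
      (2 * (1 + ‖x‖ ^ 2) ^ b - (1 + ‖x + z‖ ^ 2) ^ b - (1 + ‖x - z‖ ^ 2) ^ b) / ‖z‖ ^ p) μ := by
    refine Measurable.aestronglyMeasurable ?_
    fun_prop
  refine ⟨(hI1.add hI2).mono' hmeas (.of_forall fun z => h x z), ?_⟩
  rw [← Real.norm_eq_abs]
  refine (norm_integral_le_of_norm_le (hI1.add hI2) (.of_forall fun z => h x z)).trans ?_
  rw [integral_add' hI1 hI2, integral_const_mul, integral_const_mul,
    Measure.integral_comp_inv_smul_of_nonneg μ (fun u : E => min 1 (‖u‖ ^ 2) / ‖u‖ ^ p) hR.le]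
  simp only [Pi.add_apply]
  rw [integral_add (hf.comp_add_left x) (hf.comp_sub_left x),
    integral_add_left_eq_self (fun u : E => (1 + ‖u‖ ^ 2) ^ b),
    integral_sub_left_eq_self (fun u : E => (1 + ‖u‖ ^ 2) ^ b), ← hK, ← hF, smul_eq_mul]
  have hRd : √(1 + ‖x‖ ^ 2) ^ Module.finrank ℝ E =
      (1 + ‖x‖ ^ 2) ^ ((Module.finrank ℝ E : ℝ) / 2) := by
    rw [← Real.rpow_natCast, Real.sqrt_eq_rpow, ← Real.rpow_mul hw0.le]; ring_nf
  have hpow : (1 + ‖x‖ ^ 2) ^ (b - p / 2) * √(1 + ‖x‖ ^ 2) ^ Module.finrank ℝ E ≤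
      (1 + ‖x‖ ^ 2) ^ (-(p / 2)) := by
    rw [hRd, ← Real.rpow_add hw0]
    exact Real.rpow_le_rpow_of_exponent_le hw (by linarith)
  calc _ = C * K * ((1 + ‖x‖ ^ 2) ^ (b - p / 2) * √(1 + ‖x‖ ^ 2) ^ Module.finrank ℝ E) +
        2 ^ p * (1 + ‖x‖ ^ 2) ^ (-(p / 2)) * (F + F) := by ring
    _ ≤ C * K * (1 + ‖x‖ ^ 2) ^ (-(p / 2)) +
        2 ^ p * (1 + ‖x‖ ^ 2) ^ (-(p / 2)) * (F + F) := by gcongr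
    _ = _ := by ring

lemma setIntegral_lt_norm_sub_eq (μ : Measure E) [μ.IsAddHaarMeasure] {f : E → ℝ}
    (hf : Continuous f) {B : ℝ} (hB : ∀ x, |f x| ≤ B) {s : ℝ} (hs : 0 < s) (hs1 : s < 1)
    (x : E) {ε : ℝ} (hε : 0 < ε) :
    ∫ y in {y | ε < ‖x - y‖}, (f x - f y) / ‖x - y‖ ^ (Module.finrank ℝ E + 2 * s) ∂μ =
      2⁻¹ * ∫ z in {z | ε < ‖z‖}, (2 * f x - f (x + z) - f (x - z)) /
        ‖z‖ ^ (Module.finrank ℝ E + 2 * s) ∂μ := by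
  have hk := integrable_min_one_norm_sq_div_rpow μ hs hs1
  set p : ℝ := Module.finrank ℝ E + 2 * s
  set A : Set E := {z | ε < ‖z‖}
  have hA : MeasurableSet A := measurableSet_lt measurable_const measurable_norm
  have hfm : Measurable f := hf.measurable
  set φ : E → ℝ := A.indicator fun z => (f x - f (x - z)) / ‖z‖ ^ p with hφ
  have hB0 : 0 ≤ B := (abs_nonneg _).trans (hB x)
  have hm : 0 < min 1 (ε ^ 2) := by positivity
  have hφi : Integrable φ μ := by
    refine (hk.const_mul (2 * B / min 1 (ε ^ 2))).mono' ?_ (.of_forall fun z => ?_)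
    · exact ((by fun_prop : Measurable fun z => (f x - f (x - z)) / ‖z‖ ^ p).indicator
        hA).aestronglyMeasurable
    · by_cases hz : z ∈ A
      · have hz' : ε < ‖z‖ := hz
        have hle : min 1 (ε ^ 2) ≤ min 1 (‖z‖ ^ 2) := by gcongr
        have h2 : |f x - f (x - z)| ≤ 2 * B := by
          linarith [abs_sub (f x) (f (x - z)), hB x, hB (x - z)]
        rw [hφ, Set.indicator_of_mem hz, Real.norm_eq_abs, abs_div,
          abs_of_nonneg (by positivity : 0 ≤ ‖z‖ ^ p), ← mul_div_assoc]
        gcongr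
        rw [div_mul_eq_mul_div, le_div_iff₀ hm]
        gcongr
      · rw [hφ, Set.indicator_of_notMem hz, norm_zero]
        positivity
  have hI : ∫ y in {y | ε < ‖x - y‖}, (f x - f y) / ‖x - y‖ ^ p ∂μ = ∫ z, φ z ∂μ := by
    rw [← integral_sub_left_eq_self φ μ x, ← integral_indicator]
    · congr 1 with y
      simp only [hφ, Set.indicator, A, Set.mem_ofPred_eq, sub_sub_cancel]
    · exact measurableSet_lt measurable_const (by fun_prop)
  have hJ : ∫ z in A, (2 * f x - f (x + z) - f (x - z)) / ‖z‖ ^ p ∂μ =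
      ∫ z, (φ z + φ (-z)) ∂μ := by
    rw [← integral_indicator hA]
    congr 1 with z
    by_cases hz : ε < ‖z‖
    · simp only [hφ, Set.indicator, A, Set.mem_ofPred_eq, norm_neg, hz, if_true, sub_neg_eq_add]
      ring
    · simp [hφ, Set.indicator, A, hz]
  rw [hI, hJ, integral_add hφi hφi.comp_neg, integral_neg_eq_self φ]
  ring

/-- The limit of the truncated singular integrals is half the integral of the second difference. -/
lemma limUnder_setIntegral_lt_norm_sub (μ : Measure E) [μ.IsAddHaarMeasure] {f : E → ℝ}
    (hf : Continuous f) {B : ℝ} (hB : ∀ x, |f x| ≤ B) {s : ℝ} (hs : 0 < s) (hs1 : s < 1) (x : E)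
    (hH : Integrable (fun z : E =>
      (2 * f x - f (x + z) - f (x - z)) / ‖z‖ ^ (Module.finrank ℝ E + 2 * s)) μ) :
    limUnder (nhdsWithin (0 : ℝ) (Set.Ioi 0)) (fun ε : ℝ =>
      ∫ y in {y | ε < ‖x - y‖}, (f x - f y) / ‖x - y‖ ^ (Module.finrank ℝ E + 2 * s) ∂μ) =
      2⁻¹ * ∫ z : E, (2 * f x - f (x + z) - f (x - z)) /
        ‖z‖ ^ (Module.finrank ℝ E + 2 * s) ∂μ := by
  refine (((tendsto_setIntegral_lt_norm μ hH ?_).const_mul 2⁻¹).congr' ?_).limUnder_eq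
  · simp only [add_zero, sub_zero]
    ring
  · filter_upwards [self_mem_nhdsWithin] with ε hε
    exact (setIntegral_lt_norm_sub_eq μ hf hB hs hs1 x hε).symm

end PrincipalValue

lemma abs_laplacian_le {N : ℕ} {f : EuclideanSpace ℝ (Fin N) → ℝ} (hf : ContDiff ℝ 2 f)
    (x : EuclideanSpace ℝ (Fin N)) :
    |laplacian N f x| ≤ N * ‖fderiv ℝ (fderiv ℝ f) x‖ := by
  have hd' : Differentiable ℝ (fderiv ℝ f) :=
    (hf.fderiv_right (m := 1) (by norm_num)).differentiable (by norm_num)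
  refine (Finset.abs_sum_le_sum_abs _ _).trans ((Finset.sum_le_card_nsmul _ _
    ‖fderiv ℝ (fderiv ℝ f) x‖ fun i _ => ?_).trans_eq (by simp))
  have h : pderiv' N i (fun y => pderiv' N i f y) x =
      fderiv ℝ (fderiv ℝ f) x (EuclideanSpace.single i 1) (EuclideanSpace.single i 1) := by
    simp only [pderiv']
    rw [fderiv_clm_apply (hd' x) (differentiableAt_const _)]
    simp
  rw [h, ← Real.norm_eq_abs]
  simpa using ContinuousLinearMap.le_opNorm₂ (fderiv ℝ (fderiv ℝ f) x)
    (EuclideanSpace.single i (1 : ℝ)) (EuclideanSpace.single i (1 : ℝ))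

/-- Lemma: for `s ∈ (0,1]` and `q₀ > N`, the function `f(x) = ⟨x⟩^{-q₀} = (1+|x|²)^{-q₀/2}`
is bounded and `C^∞`, has bounded second-order derivatives, and satisfies
`|(-Δ)^s f(x)| ≤ C (1+|x|²)^{-(N+2s)/2}`. -/
theorem japanese_bracket_fracLap_bound
    (N : ℕ) (hN : 1 ≤ N) (s : ℝ) (hs : 0 < s) (hs1 : s ≤ 1) (q₀ : ℝ) (hq₀ : (N : ℝ) < q₀) :
    (∃ C : ℝ, ∀ x : EuclideanSpace ℝ (Fin N),
        |(1 + ‖x‖ ^ 2 : ℝ) ^ (-(q₀ / 2))| ≤ C) ∧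
    ContDiff ℝ (⊤ : ℕ∞) (fun x : EuclideanSpace ℝ (Fin N) => (1 + ‖x‖ ^ 2 : ℝ) ^ (-(q₀ / 2))) ∧
    (∃ C : ℝ, ∀ x : EuclideanSpace ℝ (Fin N),
        ‖iteratedFDeriv ℝ 2
          (fun x : EuclideanSpace ℝ (Fin N) => (1 + ‖x‖ ^ 2 : ℝ) ^ (-(q₀ / 2))) x‖ ≤ C) ∧
    (∃ C : ℝ, 0 < C ∧ ∀ x : EuclideanSpace ℝ (Fin N),
        |fracLapGen N s (fun y => (1 + ‖y‖ ^ 2 : ℝ) ^ (-(q₀ / 2))) x| ≤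
          C * (1 + ‖x‖ ^ 2) ^ (-(((N : ℝ) + 2 * s) / 2))) := by
  have hb : -(q₀ / 2) < 0 := by have : (0 : ℝ) ≤ N := N.cast_nonneg; linarith
  have hbd (x : EuclideanSpace ℝ (Fin N)) : |(1 + ‖x‖ ^ 2 : ℝ) ^ (-(q₀ / 2))| ≤ 1 := by
    rw [abs_of_pos (by positivity)]
    exact Real.rpow_le_one_of_one_le_of_nonpos (by nlinarith [sq_nonneg ‖x‖]) hb.le
  refine ⟨⟨1, hbd⟩, contDiff_one_add_norm_sq_rpow _, ?_, ?_⟩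
  · refine ⟨2 * |-(q₀ / 2)| + 4 * |-(q₀ / 2) - 1| * |-(q₀ / 2)|, fun x => ?_⟩
    rw [← norm_iteratedFDeriv_fderiv, norm_iteratedFDeriv_one]
    refine (norm_fderiv_fderiv_one_add_norm_sq_rpow_le _ x).trans
      (mul_le_of_le_one_right (by positivity) ?_)
    exact Real.rpow_le_one_of_one_le_of_nonpos (by nlinarith [sq_nonneg ‖x‖]) (by linarith)
  · suffices ∃ C : ℝ, ∀ x : EuclideanSpace ℝ (Fin N),
        |fracLapGen N s (fun y => (1 + ‖y‖ ^ 2 : ℝ) ^ (-(q₀ / 2))) x| ≤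
          C * (1 + ‖x‖ ^ 2) ^ (-(((N : ℝ) + 2 * s) / 2)) by
      obtain ⟨C, hC⟩ := this
      refine ⟨max C 1, by positivity, fun x => (hC x).trans ?_⟩
      gcongr
      exact le_max_left _ _
    rcases hs1.eq_or_lt with rfl | hs1
    · refine ⟨N * (2 * |-(q₀ / 2)| + 4 * |-(q₀ / 2) - 1| * |-(q₀ / 2)|), fun x => ?_⟩
      rw [fracLapGen, if_pos rfl, abs_neg, mul_assoc]
      refine (abs_laplacian_le (contDiff_one_add_norm_sq_rpow _) x).trans ?_
      gcongr
      refine (norm_fderiv_fderiv_one_add_norm_sq_rpow_le _ x).trans ?_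
      gcongr
      · nlinarith [sq_nonneg ‖x‖]
      · linarith
    · have : Nonempty (Fin N) := ⟨⟨0, hN⟩⟩
      have hfr : (Module.finrank ℝ (EuclideanSpace ℝ (Fin N)) : ℝ) = N := by simp
      obtain ⟨C, hC⟩ := exists_integral_abs_second_difference_le
        (E := EuclideanSpace ℝ (Fin N)) volume (b := -(q₀ / 2)) (by rw [hfr]; linarith) hs hs1
      refine ⟨|fracLapConst N s| * (2⁻¹ * C), fun x => ?_⟩
      obtain ⟨hint, hle⟩ := hC x
      have hlim := limUnder_setIntegral_lt_norm_sub volume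
        (contDiff_one_add_norm_sq_rpow (n := 0) (-(q₀ / 2))).continuous hbd hs hs1 x hint
      rw [hfr] at hlim hle
      rw [fracLapGen, if_neg hs1.ne, fracLap, hlim, abs_mul, abs_mul, abs_of_pos (a := (2 : ℝ)⁻¹) (by norm_num),
        mul_assoc, mul_assoc]
      gcongr

end
end

section
/- Let N ≥ 1, p > 1, α ∈ (0,2), and N < q₀ < N + αp. For R > 0 define Φ_R(x) = (1 + |x/R|²)^{−q₀/2}. Then there exists a constant C > 0, independent of R, such that ∫_{ℝ^N} Φ_R(x)^{−1/(p−1)} |ℒ Φ_R(x)|^{p/(p−1)} dx ≤ C ( R^{−2p/(p−1) + N} + R^{−αp/(p−1) + N} ). -/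
open MeasureTheory Filter
open scoped ENNReal

noncomputable section

section BracketPower

variable {E : Type*} [NormedAddCommGroup E]

/-- The bracket power `⟨x⟩^{-q} = (1 + ‖x‖²)^{-q/2}`. -/
def bracketPow (q : ℝ) (x : E) : ℝ := (1 + ‖x‖ ^ 2 : ℝ) ^ (-(q / 2))

/-- The symmetric second difference `2 f(x) - f(x + z) - f(x - z)`. -/
def secondDiff (f : E → ℝ) (x z : E) : ℝ := 2 * f x - f (x + z) - f (x - z)

lemma one_add_norm_sq_pos (x : E) : (0 : ℝ) < 1 + ‖x‖ ^ 2 := by positivity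

lemma bracketPow_pos (q : ℝ) (x : E) : 0 < bracketPow q x :=
  Real.rpow_pos_of_pos (one_add_norm_sq_pos x) _

lemma bracketPow_eq_sqrt_rpow (q : ℝ) (x : E) :
    bracketPow q x = √(1 + ‖x‖ ^ 2) ^ (-q) := by
  rw [bracketPow, Real.sqrt_eq_rpow, ← Real.rpow_mul (one_add_norm_sq_pos x).le]
  congr 1
  ring

lemma bracketPow_anti {q r : ℝ} (h : q ≤ r) (x : E) : bracketPow r x ≤ bracketPow q x :=
  Real.rpow_le_rpow_of_exponent_le (by nlinarith [sq_nonneg ‖x‖]) (by linarith)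

lemma bracketPow_le_one {q : ℝ} (hq : 0 ≤ q) (x : E) : bracketPow q x ≤ 1 :=
  Real.rpow_le_one_of_one_le_of_nonpos (by nlinarith [sq_nonneg ‖x‖]) (by linarith)

lemma continuous_bracketPow (q : ℝ) : Continuous (bracketPow q : E → ℝ) :=
  (by fun_prop : Continuous fun x : E => (1 + ‖x‖ ^ 2 : ℝ)).rpow_const
    fun x => Or.inl (one_add_norm_sq_pos x).ne'

lemma continuous_secondDiff {f : E → ℝ} (hf : Continuous f) (x : E) :
    Continuous (secondDiff f x) := by
  unfold secondDiff
  fun_prop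

lemma abs_secondDiff_le_of_hasDerivAt {g g' g'' : ℝ → ℝ} {M : ℝ}
    (hg : ∀ t, HasDerivAt g (g' t) t) (hg' : ∀ t, HasDerivAt g' (g'' t) t)
    (hM : ∀ t ∈ Set.Icc (-1 : ℝ) 1, |g'' t| ≤ M) :
    |2 * g 0 - g 1 - g (-1)| ≤ 2 * M := by
  have hM0 : 0 ≤ M := (abs_nonneg _).trans (hM 0 (by norm_num))
  have hdiff : ∀ t ∈ Set.Icc (0 : ℝ) 1, |g' t - g' (-t)| ≤ 2 * M := by
    intro t ht
    have := Convex.norm_image_sub_le_of_norm_hasDerivWithin_le (f := g') (f' := g'')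
      (s := Set.Icc (-1) 1) (C := M) (x := -t) (y := t)
      (fun s _ => (hg' s).hasDerivWithinAt) hM (convex_Icc _ _)
      ⟨by linarith [ht.2], by linarith [ht.1]⟩ ⟨by linarith [ht.1], ht.2⟩
    simp only [Real.norm_eq_abs] at this
    refine this.trans ?_
    rw [sub_neg_eq_add, abs_of_nonneg (by linarith [ht.1])]
    nlinarith [ht.2]
  have hG : ∀ t, HasDerivAt (fun t => g t + g (-t)) (g' t - g' (-t)) t := by
    intro t
    have h2 : HasDerivAt (fun t => g (-t)) (-g' (-t)) t := by
      have h : HasDerivAt (fun t => g (-t)) (g' (-t) * -1) t :=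
        (hg (-t)).comp t (hasDerivAt_neg t)
      exact h.congr_deriv (by ring)
    simpa [sub_eq_add_neg] using (hg t).fun_add h2
  have := Convex.norm_image_sub_le_of_norm_hasDerivWithin_le
    (f := fun t => g t + g (-t)) (f' := fun t => g' t - g' (-t))
    (s := Set.Icc 0 1) (C := 2 * M) (x := 0) (y := 1)
    (fun s _ => (hG s).hasDerivWithinAt) hdiff (convex_Icc _ _) (by simp) (by simp)
  rw [Real.norm_eq_abs, abs_sub_comm] at this
  simp only [neg_zero, sub_zero, norm_one, mul_one] at this
  convert this using 2
  ring

lemma abs_secondDiff_bracketPow_le_sum {q : ℝ} (x z : E) :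
    |secondDiff (bracketPow q) x z| ≤
      2 * bracketPow q x + bracketPow q (x + z) + bracketPow q (x - z) := by
  have h1 := bracketPow_pos q x
  have h2 := bracketPow_pos q (x + z)
  have h3 := bracketPow_pos q (x - z)
  rw [secondDiff, abs_le]
  constructor <;> linarith

/-- A radial majorant for the fractional Laplacian kernel tested on bounded `C²` functions. -/
def levyKernel (a : ℝ) (w : E) : ℝ := min 1 (‖w‖ ^ 2) / ‖w‖ ^ a

lemma levyKernel_nonneg (a : ℝ) (w : E) : 0 ≤ levyKernel a w := by
  unfold levyKernel
  positivity

variable [InnerProductSpace ℝ E]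

lemma hasDerivAt_one_add_norm_sq_line (x z : E) (t : ℝ) :
    HasDerivAt (fun t : ℝ => 1 + ‖x + t • z‖ ^ 2) (2 * inner ℝ (x + t • z) z) t := by
  have h : HasDerivAt (fun t : ℝ => x + t • z) z t := by
    simpa using ((hasDerivAt_id t).smul_const z).const_add x
  exact h.norm_sq.const_add 1

lemma hasDerivAt_bracketPow_line (r : ℝ) (x z : E) (t : ℝ) :
    HasDerivAt (fun t : ℝ => bracketPow r (x + t • z))
      (-r * inner ℝ (x + t • z) z * bracketPow (r + 2) (x + t • z)) t := by
  have := (hasDerivAt_one_add_norm_sq_line x z t).rpow_const (p := -(r / 2))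
    (Or.inl (one_add_norm_sq_pos _).ne')
  refine this.congr_deriv ?_
  rw [bracketPow, show -((r + 2) / 2) = -(r / 2) - 1 by ring]
  ring

lemma hasDerivAt_deriv_bracketPow_line (r : ℝ) (x z : E) (t : ℝ) :
    HasDerivAt (fun t : ℝ => -r * inner ℝ (x + t • z) z * bracketPow (r + 2) (x + t • z))
      (-r * ‖z‖ ^ 2 * bracketPow (r + 2) (x + t • z) +
        r * (r + 2) * inner ℝ (x + t • z) z ^ 2 * bracketPow (r + 4) (x + t • z)) t := by
  have h : HasDerivAt (fun t : ℝ => x + t • z) z t := by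
    simpa using ((hasDerivAt_id t).smul_const z).const_add x
  have hi : HasDerivAt (fun t : ℝ => (inner ℝ (x + t • z) z : ℝ)) (‖z‖ ^ 2) t := by
    have := h.inner ℝ (hasDerivAt_const t z)
    simpa using this
  have := (hi.const_mul (-r)).fun_mul (hasDerivAt_bracketPow_line (r + 2) x z t)
  refine this.congr_deriv ?_
  rw [show r + 4 = r + 2 + 2 by ring]
  ring

lemma abs_second_deriv_bracketPow_le {r : ℝ} (hr : 0 ≤ r) (y z : E) :
    |-r * ‖z‖ ^ 2 * bracketPow (r + 2) y + r * (r + 2) * inner ℝ y z ^ 2 * bracketPow (r + 4) y|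
      ≤ r * (r + 3) * bracketPow (r + 2) y * ‖z‖ ^ 2 := by
  have hb : bracketPow (r + 4) y * (1 + ‖y‖ ^ 2) = bracketPow (r + 2) y := by
    rw [bracketPow, bracketPow, ← Real.rpow_add_one (one_add_norm_sq_pos y).ne']
    congr 1
    ring
  have hi : (inner ℝ y z : ℝ) ^ 2 ≤ (1 + ‖y‖ ^ 2) * ‖z‖ ^ 2 := by
    have h1 : (inner ℝ y z : ℝ) ^ 2 ≤ (‖y‖ * ‖z‖) ^ 2 :=
      sq_le_sq.2 ((abs_real_inner_le_norm y z).trans (le_abs_self _))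
    nlinarith [sq_nonneg ‖z‖]
  have h4 := (bracketPow_pos (r + 4) y).le
  have h2 := (bracketPow_pos (r + 2) y).le
  have hsecond : inner ℝ y z ^ 2 * bracketPow (r + 4) y ≤ bracketPow (r + 2) y * ‖z‖ ^ 2 := by
    calc inner ℝ y z ^ 2 * bracketPow (r + 4) y
        ≤ (1 + ‖y‖ ^ 2) * ‖z‖ ^ 2 * bracketPow (r + 4) y := by gcongr
      _ = bracketPow (r + 2) y * ‖z‖ ^ 2 := by rw [← hb]; ring
  have h5 : 0 ≤ inner ℝ y z ^ 2 * bracketPow (r + 4) y := by positivity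
  have h6 : 0 ≤ bracketPow (r + 2) y * ‖z‖ ^ 2 := by positivity
  have h7 := mul_le_mul_of_nonneg_left hsecond (by positivity : 0 ≤ r * (r + 2))
  have h8 : 0 ≤ r * (bracketPow (r + 2) y * ‖z‖ ^ 2) := by positivity
  have h9 : 0 ≤ r * (r + 2) * (inner ℝ y z ^ 2 * bracketPow (r + 4) y) := by positivity
  have h10 : 0 ≤ r * (r + 2) * (bracketPow (r + 2) y * ‖z‖ ^ 2) := by positivity
  rw [abs_le]
  constructor <;> nlinarith

/-- Second differences of `⟨x⟩^{-q}` are quadratically small at scales below `⟨x⟩ / 2`. -/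
lemma abs_secondDiff_bracketPow_le {q : ℝ} (hq : 0 ≤ q) {x z : E}
    (hz : ‖z‖ ^ 2 ≤ (1 + ‖x‖ ^ 2) / 4) :
    |secondDiff (bracketPow q) x z| ≤
      2 * (q * (q + 3) * 4 ^ ((q + 2) / 2)) * bracketPow (q + 2) x * ‖z‖ ^ 2 := by
  have key := abs_secondDiff_le_of_hasDerivAt
    (M := q * (q + 3) * (4 ^ ((q + 2) / 2) * bracketPow (q + 2) x) * ‖z‖ ^ 2)
    (hasDerivAt_bracketPow_line q x z) (hasDerivAt_deriv_bracketPow_line q x z) ?_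
  · simp only [zero_smul, add_zero, one_smul, neg_smul, ← sub_eq_add_neg] at key
    refine key.trans_eq ?_
    ring
  · intro t ht
    refine (abs_second_deriv_bracketPow_le hq (x + t • z) z).trans ?_
    have htz : ‖t • z‖ ≤ ‖z‖ := by
      rw [norm_smul]
      exact mul_le_of_le_one_left (norm_nonneg _) (abs_le.2 ht)
    have hx : ‖x‖ ≤ ‖x + t • z‖ + ‖z‖ := by
      calc ‖x‖ = ‖(x + t • z) - t • z‖ := by simp
        _ ≤ ‖x + t • z‖ + ‖t • z‖ := norm_sub_le _ _
        _ ≤ _ := by gcongr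
    have hlow : (1 + ‖x‖ ^ 2) / 4 ≤ 1 + ‖x + t • z‖ ^ 2 := by
      nlinarith [sq_nonneg (‖x + t • z‖ - ‖z‖), norm_nonneg x, norm_nonneg z,
        norm_nonneg (x + t • z)]
    have hpow : bracketPow (q + 2) (x + t • z) ≤ 4 ^ ((q + 2) / 2) * bracketPow (q + 2) x := by
      calc bracketPow (q + 2) (x + t • z) ≤ ((1 + ‖x‖ ^ 2) / 4) ^ (-((q + 2) / 2)) :=
            Real.rpow_le_rpow_of_nonpos (by positivity) hlow (by linarith)
        _ = 4 ^ ((q + 2) / 2) * bracketPow (q + 2) x := by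
            rw [Real.div_rpow (by positivity) (by norm_num), Real.rpow_neg (by norm_num : (0:ℝ) ≤ 4),
              div_inv_eq_mul, mul_comm, bracketPow]
    gcongr

lemma exists_abs_secondDiff_div_le {q a : ℝ} (hq : 0 ≤ q) (ha : 0 ≤ a) :
    ∃ C : ℝ, 0 ≤ C ∧ ∀ x z : E, |secondDiff (bracketPow q) x z| / ‖z‖ ^ a ≤
      C * (bracketPow (q + a) x * levyKernel a ((√(1 + ‖x‖ ^ 2))⁻¹ • z) +
        bracketPow a x * (bracketPow q (x + z) + bracketPow q (x - z))) := by
  set A := 2 * (q * (q + 3) * 4 ^ ((q + 2) / 2)) with hA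
  have hA0 : 0 ≤ A := by positivity
  have h2a : (0 : ℝ) ≤ 2 ^ a := by positivity
  refine ⟨A + 8 + 2 ^ a, by positivity, fun x z => ?_⟩
  have hp0 := bracketPow_pos q x
  have hp1 := bracketPow_pos q (x + z)
  have hp2 := bracketPow_pos q (x - z)
  have hpa := bracketPow_pos a x
  have hpqa : bracketPow (q + a) x = bracketPow q x * bracketPow a x := by
    rw [bracketPow, bracketPow, bracketPow, ← Real.rpow_add (one_add_norm_sq_pos x)]
    congr 1
    ring
  set w := (√(1 + ‖x‖ ^ 2))⁻¹ • z with hw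
  have hK := levyKernel_nonneg a w
  have hρ : 0 < √(1 + ‖x‖ ^ 2) := Real.sqrt_pos.2 (one_add_norm_sq_pos x)
  have hwn : ‖z‖ = √(1 + ‖x‖ ^ 2) * ‖w‖ := by
    rw [hw, norm_smul, norm_inv, Real.norm_of_nonneg hρ.le, mul_inv_cancel_left₀ hρ.ne']
  have hza : (‖z‖ ^ a)⁻¹ = bracketPow a x * (‖w‖ ^ a)⁻¹ := by
    rw [hwn, Real.mul_rpow hρ.le (norm_nonneg _), mul_inv, bracketPow_eq_sqrt_rpow,
      Real.rpow_neg hρ.le]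
  have hz2 : ‖z‖ ^ 2 = (1 + ‖x‖ ^ 2) * ‖w‖ ^ 2 := by
    rw [hwn, mul_pow, Real.sq_sqrt (one_add_norm_sq_pos x).le]
  have hterm1 : 0 ≤ bracketPow (q + a) x * levyKernel a w :=
    mul_nonneg (bracketPow_pos _ _).le hK
  have hterm2 : 0 ≤ bracketPow a x * (bracketPow q (x + z) + bracketPow q (x - z)) := by positivity
  rcases le_or_gt ‖w‖ (1 / 2) with hle | hgt
  · have hw2 : ‖w‖ ^ 2 ≤ 1 / 4 := by nlinarith [norm_nonneg w]
    have h := abs_secondDiff_bracketPow_le hq (x := x) (z := z)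
      (by rw [hz2]; nlinarith [one_add_norm_sq_pos x])
    have hq2 : bracketPow (q + 2) x * (1 + ‖x‖ ^ 2) = bracketPow q x := by
      rw [bracketPow, bracketPow, ← Real.rpow_add_one (one_add_norm_sq_pos x).ne']
      congr 1
      ring
    calc |secondDiff (bracketPow q) x z| / ‖z‖ ^ a
        ≤ (A * bracketPow (q + 2) x * ‖z‖ ^ 2) * (‖z‖ ^ a)⁻¹ := by
          rw [div_eq_mul_inv]; gcongr
      _ = A * (bracketPow (q + a) x * levyKernel a w) := by
          rw [hza, hz2, levyKernel, min_eq_right (by linarith), hpqa, ← hq2]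
          ring
      _ ≤ _ := by nlinarith
  · have hmin : 1 / 4 ≤ min 1 (‖w‖ ^ 2) := le_min (by norm_num) (by nlinarith)
    have hwa : (‖w‖ ^ a)⁻¹ ≤ 2 ^ a := by
      rw [← Real.inv_rpow (norm_nonneg _)]
      refine Real.rpow_le_rpow (by positivity) ?_ ha
      rw [inv_le_comm₀ (by linarith) (by norm_num)]
      linarith
    have hwa0 : 0 ≤ (‖w‖ ^ a)⁻¹ := by positivity
    have hfirst : bracketPow q x * (bracketPow a x * (‖w‖ ^ a)⁻¹) ≤
        4 * (bracketPow (q + a) x * levyKernel a w) := by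
      rw [levyKernel, hpqa, div_eq_mul_inv]
      have : 0 ≤ bracketPow q x * (bracketPow a x * (‖w‖ ^ a)⁻¹) := by positivity
      nlinarith
    have hsecond : (bracketPow q (x + z) + bracketPow q (x - z)) *
        (bracketPow a x * (‖w‖ ^ a)⁻¹) ≤
        2 ^ a * (bracketPow a x * (bracketPow q (x + z) + bracketPow q (x - z))) := by
      have := mul_le_mul_of_nonneg_left hwa hterm2
      linarith
    calc |secondDiff (bracketPow q) x z| / ‖z‖ ^ a
        ≤ (2 * bracketPow q x + bracketPow q (x + z) + bracketPow q (x - z)) * (‖z‖ ^ a)⁻¹ := by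
          rw [div_eq_mul_inv]
          gcongr
          exact abs_secondDiff_bracketPow_le_sum x z
      _ ≤ 8 * (bracketPow (q + a) x * levyKernel a w) +
          2 ^ a * (bracketPow a x * (bracketPow q (x + z) + bracketPow q (x - z))) := by
          rw [hza]; linarith
      _ ≤ _ := by nlinarith

end BracketPower

section FractionalLaplacian

variable {N : ℕ}

lemma integrable_levyKernel (hN : 1 ≤ N) {α : ℝ} (hα : 0 < α) (hα2 : α < 2) :
    Integrable (levyKernel ((N : ℝ) + α) : EuclideanSpace ℝ (Fin N) → ℝ) := by
  have : Nontrivial (EuclideanSpace ℝ (Fin N)) :=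
    Module.nontrivial_of_finrank_pos (R := ℝ) (by simpa using Nat.lt_of_succ_le hN)
  refine (integrable_fun_norm_addHaar (volume : Measure (EuclideanSpace ℝ (Fin N)))
    (f := fun r : ℝ => min 1 (r ^ 2) / r ^ ((N : ℝ) + α))).2 ?_
  rw [finrank_euclideanSpace_fin, ← Set.Ioc_union_Ioi_eq_Ioi zero_le_one]
  have hpow : ∀ {y : ℝ}, 0 < y → y ^ (N - 1) = y ^ ((N : ℝ) - 1) := by
    intro y _
    rw [← Real.rpow_natCast, Nat.cast_sub hN, Nat.cast_one]
  refine IntegrableOn.union ?_ ?_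
  · have h := (intervalIntegral.intervalIntegrable_rpow' (a := 0) (b := 1) (r := 1 - α)
      (by linarith)).1
    refine h.congr_fun (fun y hy => ?_) measurableSet_Ioc
    have hy0 : 0 < y := hy.1
    simp only [smul_eq_mul]
    rw [min_eq_right (by nlinarith [hy.2]), hpow hy0, ← Real.rpow_two, ← Real.rpow_sub hy0,
      ← Real.rpow_add hy0]
    congr 1
    ring
  · have h := integrableOn_Ioi_rpow_of_lt (a := -1 - α) (by linarith) zero_lt_one
    refine h.congr_fun (fun y hy => ?_) measurableSet_Ioi
    have hy1 : 1 < y := hy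
    have hy0 : 0 < y := by linarith
    simp only [smul_eq_mul]
    rw [min_eq_left (by nlinarith), hpow hy0, one_div, ← Real.rpow_neg hy0.le,
      ← Real.rpow_add hy0]
    congr 1
    ring

lemma integrable_bracketPow {q : ℝ} (hq : (N : ℝ) < q) :
    Integrable (bracketPow q : EuclideanSpace ℝ (Fin N) → ℝ) := by
  have := integrable_rpow_neg_one_add_norm_sq (E := EuclideanSpace ℝ (Fin N))
    (μ := volume) (r := q) (by simpa using hq)
  simpa only [neg_div] using! this

lemma exists_integral_abs_secondDiff_le (hN : 1 ≤ N) {α : ℝ} (hα : 0 < α) (hα2 : α < 2)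
    {q : ℝ} (hq : (N : ℝ) < q) :
    ∃ C : ℝ, 0 ≤ C ∧ ∀ x : EuclideanSpace ℝ (Fin N),
      Integrable (fun z => |secondDiff (bracketPow q) x z| / ‖z‖ ^ ((N : ℝ) + α)) ∧
      ∫ z, |secondDiff (bracketPow q) x z| / ‖z‖ ^ ((N : ℝ) + α) ≤
        C * bracketPow ((N : ℝ) + α) x := by
  have hN0 : (0 : ℝ) ≤ N := N.cast_nonneg
  set a : ℝ := (N : ℝ) + α
  obtain ⟨C, hC, hle⟩ := exists_abs_secondDiff_div_le (E := EuclideanSpace ℝ (Fin N))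
    (q := q) (a := a) (by linarith) (by positivity)
  have hK := integrable_levyKernel hN hα hα2
  have hΦ := integrable_bracketPow hq
  set IK := ∫ w : EuclideanSpace ℝ (Fin N), levyKernel a w
  set IΦ := ∫ w : EuclideanSpace ℝ (Fin N), bracketPow q w
  have hIK : 0 ≤ IK := integral_nonneg fun w => levyKernel_nonneg _ w
  have hIΦ : 0 ≤ IΦ := integral_nonneg fun w => (bracketPow_pos _ w).le
  refine ⟨C * (IK + 2 * IΦ), by positivity, fun x => ?_⟩
  set ρ := √(1 + ‖x‖ ^ 2) with hρdef
  have hρ1 : 1 ≤ ρ := Real.one_le_sqrt.2 (by nlinarith [sq_nonneg ‖x‖])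
  have hρ : 0 < ρ := by linarith
  have hK' : Integrable fun z : EuclideanSpace ℝ (Fin N) => levyKernel a (ρ⁻¹ • z) :=
    hK.comp_smul (inv_ne_zero hρ.ne')
  have hp : Integrable fun z : EuclideanSpace ℝ (Fin N) => bracketPow q (x + z) :=
    hΦ.comp_add_left x
  have hm : Integrable fun z : EuclideanSpace ℝ (Fin N) => bracketPow q (x - z) :=
    hΦ.comp_sub_left x
  have hbound : Integrable fun z => C * (bracketPow (q + a) x * levyKernel a (ρ⁻¹ • z) +
      bracketPow a x * (bracketPow q (x + z) + bracketPow q (x - z))) :=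
    ((hK'.const_mul _).fun_add ((hp.fun_add hm).const_mul _)).const_mul _
  have hinteg : Integrable (fun z => |secondDiff (bracketPow q) x z| / ‖z‖ ^ a) := by
    refine hbound.mono' ?_ (Eventually.of_forall fun z => ?_)
    · have hc := (continuous_secondDiff (continuous_bracketPow q) x).measurable
      exact Measurable.aestronglyMeasurable (by fun_prop)
    · rw [Real.norm_of_nonneg (by positivity)]
      exact hle x z
  refine ⟨hinteg, (integral_mono hinteg hbound (hle x)).trans ?_⟩
  have hval : ∫ z, C * (bracketPow (q + a) x * levyKernel a (ρ⁻¹ • z) +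
      bracketPow a x * (bracketPow q (x + z) + bracketPow q (x - z))) =
      C * (bracketPow (q + a) x * (ρ ^ N * IK) + bracketPow a x * (IΦ + IΦ)) := by
    rw [integral_const_mul, integral_add (hK'.const_mul _) ((hp.fun_add hm).const_mul _),
      integral_const_mul, integral_const_mul, integral_add hp hm,
      Measure.integral_comp_inv_smul, integral_add_left_eq_self (μ := volume) (bracketPow q) x,
      integral_sub_left_eq_self (bracketPow q) volume x, finrank_euclideanSpace_fin,
      abs_of_pos (pow_pos hρ N), smul_eq_mul]
  rw [hval]
  have hscale : bracketPow (q + a) x * ρ ^ N ≤ bracketPow a x := by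
    rw [bracketPow_eq_sqrt_rpow, bracketPow_eq_sqrt_rpow, ← hρdef, ← Real.rpow_natCast,
      ← Real.rpow_add hρ]
    exact Real.rpow_le_rpow_of_exponent_le hρ1 (by linarith)
  have := mul_le_mul_of_nonneg_right hscale hIK
  rw [mul_assoc C]
  refine mul_le_mul_of_nonneg_left ?_ hC
  linarith

lemma integrable_indicator_div_norm_rpow {a : ℝ} (ha : (N : ℝ) < a) {ε : ℝ} (hε : 0 < ε)
    {h : EuclideanSpace ℝ (Fin N) → ℝ} (hh : Continuous h) {B : ℝ} (hB : ∀ z, |h z| ≤ B) :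
    Integrable ({z : EuclideanSpace ℝ (Fin N) | ε < ‖z‖}.indicator
      fun z => h z / ‖z‖ ^ a) := by
  have ha0 : 0 ≤ a := N.cast_nonneg.trans ha.le
  have hB0 : 0 ≤ B := (abs_nonneg _).trans (hB 0)
  have hinteg := (integrable_one_add_norm (E := EuclideanSpace ℝ (Fin N)) (μ := volume)
    (r := a) (by simpa using ha)).const_mul (B * (1 + ε⁻¹) ^ a)
  have hmeas := hh.measurable
  refine hinteg.mono' ?_ (Eventually.of_forall fun z => ?_)
  · refine Measurable.aestronglyMeasurable (Measurable.indicator (by fun_prop) ?_)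
    exact measurableSet_lt measurable_const measurable_norm
  · by_cases hz : ε < ‖z‖
    · have hz0 : 0 < ‖z‖ := hε.trans hz
      rw [Set.indicator_of_mem (by exact hz), norm_div, Real.norm_eq_abs,
        Real.norm_of_nonneg (by positivity : 0 ≤ ‖z‖ ^ a), div_eq_mul_inv, mul_assoc]
      refine mul_le_mul (hB z) ?_ (by positivity) hB0
      rw [Real.rpow_neg (by positivity), ← div_eq_mul_inv, ← Real.div_rpow (by positivity)
        (by positivity), ← Real.inv_rpow (by positivity)]
      refine Real.rpow_le_rpow (by positivity) ?_ ha0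
      rw [inv_eq_one_div, div_le_div_iff₀ hz0 (by positivity)]
      have : 1 ≤ ε⁻¹ * ‖z‖ := by
        rw [← inv_mul_cancel₀ hε.ne']
        gcongr
      linarith
    · rw [Set.indicator_of_notMem (by exact hz), norm_zero]
      positivity

lemma integral_truncated_eq_secondDiff {f : EuclideanSpace ℝ (Fin N) → ℝ} (hf : Continuous f)
    {B : ℝ} (hB : ∀ x, |f x| ≤ B) {a : ℝ} (ha : (N : ℝ) < a) {ε : ℝ} (hε : 0 < ε)
    (x : EuclideanSpace ℝ (Fin N)) :
    ∫ y in {y : EuclideanSpace ℝ (Fin N) | ε < ‖x - y‖}, (f x - f y) / ‖x - y‖ ^ a =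
      2⁻¹ * ∫ z, {z : EuclideanSpace ℝ (Fin N) | ε < ‖z‖}.indicator
        (fun z => secondDiff f x z / ‖z‖ ^ a) z := by
  set S : Set (EuclideanSpace ℝ (Fin N)) := {z | ε < ‖z‖}
  set g : EuclideanSpace ℝ (Fin N) → ℝ := S.indicator fun z => (f x - f (x - z)) / ‖z‖ ^ a
    with hg
  have hleft : ∫ y in {y : EuclideanSpace ℝ (Fin N) | ε < ‖x - y‖},
      (f x - f y) / ‖x - y‖ ^ a = ∫ z, g z := by
    rw [← integral_indicator (measurableSet_lt measurable_const (by fun_prop)),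
      ← integral_sub_left_eq_self g volume x]
    congr 1
    ext y
    simp [hg, S, Set.indicator]
  have hdiff : ∀ y, |f x - f y| ≤ B + B := fun y =>
    (abs_sub _ _).trans (add_le_add (hB x) (hB y))
  have hg1 : Integrable g := integrable_indicator_div_norm_rpow ha hε (by fun_prop)
    fun z => hdiff _
  have hg2 : Integrable fun z => g (-z) := hg1.comp_neg
  have hneg : ∫ z, g (-z) = ∫ z, g z := integral_neg_eq_self g volume
  have hsum : ∫ z, S.indicator (fun z => secondDiff f x z / ‖z‖ ^ a) z =
      (∫ z, g z) + ∫ z, g (-z) := by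
    rw [← integral_add hg1 hg2]
    congr 1
    ext z
    by_cases hz : ε < ‖z‖
    · simp only [hg, S, Set.indicator, Set.mem_ofPred_eq, norm_neg, hz, if_true, secondDiff,
        sub_neg_eq_add]
      ring
    · simp [hg, S, Set.indicator, hz]
  rw [hleft, hsum, hneg]
  ring

/-- The principal value exists and equals the symmetrised absolutely convergent integral. -/
lemma tendsto_principalValue {f : EuclideanSpace ℝ (Fin N) → ℝ} (hf : Continuous f)
    {B : ℝ} (hB : ∀ x, |f x| ≤ B) {a : ℝ} (ha : (N : ℝ) < a) (x : EuclideanSpace ℝ (Fin N))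
    (hinteg : Integrable fun z => |secondDiff f x z| / ‖z‖ ^ a) :
    Tendsto (fun ε : ℝ => ∫ y in {y : EuclideanSpace ℝ (Fin N) | ε < ‖x - y‖},
        (f x - f y) / ‖x - y‖ ^ a) (nhdsWithin 0 (Set.Ioi 0))
      (nhds (2⁻¹ * ∫ z, secondDiff f x z / ‖z‖ ^ a)) := by
  have hmeas : Measurable (secondDiff f x) := (continuous_secondDiff hf x).measurable
  have hlim : Tendsto (fun ε : ℝ => ∫ z, {z : EuclideanSpace ℝ (Fin N) | ε < ‖z‖}.indicator
      (fun z => secondDiff f x z / ‖z‖ ^ a) z) (nhdsWithin 0 (Set.Ioi 0))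
      (nhds (∫ z, secondDiff f x z / ‖z‖ ^ a)) := by
    refine tendsto_integral_filter_of_dominated_convergence _ (Eventually.of_forall fun ε => ?_)
      (Eventually.of_forall fun ε => Eventually.of_forall fun z => ?_) hinteg
      (Eventually.of_forall fun z => ?_)
    · refine Measurable.aestronglyMeasurable (Measurable.indicator (by fun_prop) ?_)
      exact measurableSet_lt measurable_const measurable_norm
    · refine (norm_indicator_le_norm_self _ _).trans_eq ?_
      rw [norm_div, Real.norm_eq_abs, Real.norm_of_nonneg (by positivity : 0 ≤ ‖z‖ ^ a)]
    · rcases eq_or_ne z 0 with rfl | hz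
      · have h0 : secondDiff f x 0 = 0 := by simp [secondDiff]; ring
        simp [Set.indicator, h0]
      · refine tendsto_const_nhds.congr' ?_
        filter_upwards [nhdsWithin_le_nhds (Iio_mem_nhds (norm_pos_iff.2 hz))] with ε hε
        rw [Set.indicator_of_mem (by exact hε)]
  refine (hlim.const_mul 2⁻¹).congr' ?_
  filter_upwards [self_mem_nhdsWithin] with ε hε
  exact (integral_truncated_eq_secondDiff hf hB ha hε x).symm

lemma abs_fracLap_le {f : EuclideanSpace ℝ (Fin N) → ℝ} (hf : Continuous f)
    {B : ℝ} (hB : ∀ x, |f x| ≤ B) {s : ℝ} (hs : 0 < s) (x : EuclideanSpace ℝ (Fin N))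
    (hinteg : Integrable fun z => |secondDiff f x z| / ‖z‖ ^ ((N : ℝ) + 2 * s)) :
    |fracLap N s f x| ≤
      |fracLapConst N s| * ∫ z, |secondDiff f x z| / ‖z‖ ^ ((N : ℝ) + 2 * s) := by
  rw [fracLap, (tendsto_principalValue hf hB (by linarith) x hinteg).limUnder_eq, abs_mul]
  refine mul_le_mul_of_nonneg_left ?_ (abs_nonneg _)
  have h : |∫ z, secondDiff f x z / ‖z‖ ^ ((N : ℝ) + 2 * s)| ≤
      ∫ z, |secondDiff f x z| / ‖z‖ ^ ((N : ℝ) + 2 * s) := by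
    refine (abs_integral_le_integral_abs).trans_eq ?_
    congr 1
    ext z
    rw [abs_div, abs_of_nonneg (by positivity : 0 ≤ ‖z‖ ^ ((N : ℝ) + 2 * s))]
  rw [abs_mul, abs_of_pos (by norm_num : (0 : ℝ) < 2⁻¹)]
  linarith [abs_nonneg (∫ z, secondDiff f x z / ‖z‖ ^ ((N : ℝ) + 2 * s))]

lemma exists_abs_fracLap_bracketPow_le (hN : 1 ≤ N) {α : ℝ} (hα : 0 < α) (hα2 : α < 2)
    {q : ℝ} (hq : (N : ℝ) < q) :
    ∃ C : ℝ, 0 ≤ C ∧ ∀ R : ℝ, 0 < R → ∀ x : EuclideanSpace ℝ (Fin N),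
      |fracLap N (α / 2) (fun y => bracketPow q (R⁻¹ • y)) x| ≤
        C * R ^ (-α) * bracketPow ((N : ℝ) + α) (R⁻¹ • x) := by
  obtain ⟨C, hC, hle⟩ := exists_integral_abs_secondDiff_le hN hα hα2 hq
  refine ⟨|fracLapConst N (α / 2)| * C, by positivity, fun R hR x => ?_⟩
  have hq0 : 0 ≤ q := N.cast_nonneg.trans hq.le
  have he : (N : ℝ) + 2 * (α / 2) = N + α := by ring
  have hscale : (fun z => |secondDiff (fun y => bracketPow q (R⁻¹ • y)) x z| /
      ‖z‖ ^ ((N : ℝ) + 2 * (α / 2))) = fun z => R ^ (-((N : ℝ) + α)) *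
        (fun z => |secondDiff (bracketPow q) (R⁻¹ • x) z| / ‖z‖ ^ ((N : ℝ) + α)) (R⁻¹ • z) := by
    ext z
    have hn : ‖z‖ ^ ((N : ℝ) + α) = R ^ ((N : ℝ) + α) * ‖R⁻¹ • z‖ ^ ((N : ℝ) + α) := by
      rw [← Real.mul_rpow hR.le (norm_nonneg _), norm_smul, norm_inv, Real.norm_of_nonneg hR.le,
        mul_inv_cancel_left₀ hR.ne']
    rw [he, hn, Real.rpow_neg hR.le]
    simp only [secondDiff, smul_add, smul_sub, div_eq_mul_inv, mul_inv]
    ring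
  have hinteg : Integrable fun z => |secondDiff (fun y => bracketPow q (R⁻¹ • y)) x z| /
      ‖z‖ ^ ((N : ℝ) + 2 * (α / 2)) := by
    rw [hscale]
    exact ((hle (R⁻¹ • x)).1.comp_smul (inv_ne_zero hR.ne')).const_mul _
  have hcont : Continuous fun y : EuclideanSpace ℝ (Fin N) => bracketPow q (R⁻¹ • y) :=
    (continuous_bracketPow q).comp (continuous_const_smul _)
  refine (abs_fracLap_le hcont (B := 1) (fun y => ?_) (half_pos hα) x hinteg).trans ?_
  · rw [abs_of_pos (bracketPow_pos _ _)]
    exact bracketPow_le_one hq0 _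
  · rw [hscale, integral_const_mul, Measure.integral_comp_inv_smul volume
      (fun z => |secondDiff (bracketPow q) (R⁻¹ • x) z| / ‖z‖ ^ ((N : ℝ) + α)),
      finrank_euclideanSpace_fin, abs_of_pos (pow_pos hR N), smul_eq_mul,
      ← mul_assoc (R ^ (-((N : ℝ) + α))),
      ← Real.rpow_natCast, ← Real.rpow_add hR, show -((N : ℝ) + α) + N = -α by ring]
    have := mul_le_mul_of_nonneg_left (hle (R⁻¹ • x)).2
      (by positivity : 0 ≤ |fracLapConst N (α / 2)| * R ^ (-α))
    refine le_of_eq_of_le ?_ (this.trans_eq ?_) <;> ring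

end FractionalLaplacian

section Laplacian

variable {N : ℕ}

lemma differentiable_bracketPow (q : ℝ) :
    Differentiable ℝ (bracketPow q : EuclideanSpace ℝ (Fin N) → ℝ) := fun x =>
  ((differentiableAt_id.norm_sq ℝ).const_add 1).rpow_const
    (Or.inl (one_add_norm_sq_pos x).ne')

lemma fderiv_apply_eq_of_hasDerivAt_line {f : EuclideanSpace ℝ (Fin N) → ℝ}
    {x v : EuclideanSpace ℝ (Fin N)} {d : ℝ} (hf : DifferentiableAt ℝ f x)
    (h : HasDerivAt (fun t : ℝ => f (x + t • v)) d 0) : fderiv ℝ f x v = d :=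
  HasDerivAt.unique (hf.hasFDerivAt.hasLineDerivAt v) h

lemma pderiv'_bracketPow (q : ℝ) (i : Fin N) (x : EuclideanSpace ℝ (Fin N)) :
    pderiv' N i (bracketPow q) x =
      -q * inner ℝ x (EuclideanSpace.single i 1) * bracketPow (q + 2) x := by
  refine fderiv_apply_eq_of_hasDerivAt_line (differentiable_bracketPow q x) ?_
  simpa using hasDerivAt_bracketPow_line q x (EuclideanSpace.single i 1) 0

lemma pderiv'_pderiv'_bracketPow (q : ℝ) (i : Fin N) (x : EuclideanSpace ℝ (Fin N)) :
    pderiv' N i (fun y => pderiv' N i (bracketPow q) y) x =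
      -q * ‖(EuclideanSpace.single i 1 : EuclideanSpace ℝ (Fin N))‖ ^ 2 * bracketPow (q + 2) x +
        q * (q + 2) * inner ℝ x (EuclideanSpace.single i 1) ^ 2 * bracketPow (q + 4) x := by
  simp only [pderiv'_bracketPow]
  refine fderiv_apply_eq_of_hasDerivAt_line ?_ ?_
  · exact ((differentiableAt_id.inner ℝ (differentiableAt_const _)).const_mul _).fun_mul
      (differentiable_bracketPow (q + 2) x)
  · have := hasDerivAt_deriv_bracketPow_line q x (EuclideanSpace.single i 1) 0
    simpa only [zero_smul, add_zero] using this

lemma pderiv'_comp_smul (f : EuclideanSpace ℝ (Fin N) → ℝ) (c : ℝ) (i : Fin N)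
    (x : EuclideanSpace ℝ (Fin N)) :
    pderiv' N i (fun y => f (c • y)) x = c * pderiv' N i f (c • x) := by
  rw [pderiv', fderiv_comp_smul, pderiv']
  rfl

lemma pderiv'_const_mul (f : EuclideanSpace ℝ (Fin N) → ℝ) (c : ℝ) (i : Fin N)
    (x : EuclideanSpace ℝ (Fin N)) :
    pderiv' N i (fun y => c * f y) x = c * pderiv' N i f x := by
  have h : fderiv ℝ (fun y => c * f y) x = c • fderiv ℝ f x :=
    congrFun (fderiv_const_smul_field (f := f) c) x
  rw [pderiv', h, pderiv']
  rfl

lemma laplacian_comp_smul (f : EuclideanSpace ℝ (Fin N) → ℝ) (c : ℝ)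
    (x : EuclideanSpace ℝ (Fin N)) :
    laplacian N (fun y => f (c • y)) x = c ^ 2 * laplacian N f (c • x) := by
  rw [laplacian, laplacian, Finset.mul_sum]
  refine Finset.sum_congr rfl fun i _ => ?_
  simp only [pderiv'_comp_smul, pderiv'_const_mul]
  ring

lemma abs_laplacian_bracketPow_le {q : ℝ} (hq : 0 ≤ q) (x : EuclideanSpace ℝ (Fin N)) :
    |laplacian N (bracketPow q) x| ≤ N * (q * (q + 3)) * bracketPow (q + 2) x := by
  rw [laplacian]
  refine (Finset.abs_sum_le_sum_abs _ _).trans ?_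
  have : ∀ i ∈ Finset.univ, |pderiv' N i (fun y => pderiv' N i (bracketPow q) y) x| ≤
      q * (q + 3) * bracketPow (q + 2) x := by
    intro i _
    rw [pderiv'_pderiv'_bracketPow]
    refine (abs_second_deriv_bracketPow_le hq x _).trans_eq ?_
    simp
  refine (Finset.sum_le_sum this).trans_eq ?_
  simp
  ring

lemma exists_abs_mixedOp_bracketPow_le (hN : 1 ≤ N) {α : ℝ} (hα : 0 < α) (hα2 : α < 2)
    {q : ℝ} (hq : (N : ℝ) < q) :
    ∃ C : ℝ, 0 < C ∧ ∀ R : ℝ, 0 < R → ∀ x : EuclideanSpace ℝ (Fin N),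
      |mixedOp N α (fun y => bracketPow q (R⁻¹ • y)) x| ≤
        C * (R ^ (-2 : ℝ) + R ^ (-α)) * bracketPow ((N : ℝ) + α) (R⁻¹ • x) := by
  obtain ⟨C, hC, hle⟩ := exists_abs_fracLap_bracketPow_le hN hα hα2 hq
  have hq0 : 0 ≤ q := N.cast_nonneg.trans hq.le
  refine ⟨N * (q * (q + 3)) + C + 1, by positivity, fun R hR x => ?_⟩
  have hb := bracketPow_pos ((N : ℝ) + α) (R⁻¹ • x)
  have hlap : |laplacian N (fun y => bracketPow q (R⁻¹ • y)) x| ≤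
      N * (q * (q + 3)) * (R ^ (-2 : ℝ) * bracketPow ((N : ℝ) + α) (R⁻¹ • x)) := by
    have hR2 : R⁻¹ ^ 2 = R ^ (-2 : ℝ) := by
      rw [Real.rpow_neg hR.le, Real.rpow_two, inv_pow]
    rw [laplacian_comp_smul, abs_mul, hR2, abs_of_pos (Real.rpow_pos_of_pos hR _)]
    have := (abs_laplacian_bracketPow_le hq0 (R⁻¹ • x)).trans (mul_le_mul_of_nonneg_left
      (bracketPow_anti (by linarith : (N : ℝ) + α ≤ q + 2) (R⁻¹ • x))
      (by positivity : (0 : ℝ) ≤ N * (q * (q + 3))))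
    have := mul_le_mul_of_nonneg_left this (by positivity : 0 ≤ R ^ (-2 : ℝ))
    linarith
  have hfrac := hle R hR x
  rw [mixedOp]
  refine (abs_add_le _ _).trans ?_
  rw [abs_neg]
  have h2 : 0 ≤ R ^ (-2 : ℝ) * bracketPow ((N : ℝ) + α) (R⁻¹ • x) := by positivity
  have h3 : 0 ≤ R ^ (-α) * bracketPow ((N : ℝ) + α) (R⁻¹ • x) := by positivity
  have h4 : (0 : ℝ) ≤ N * (q * (q + 3)) := by positivity
  nlinarith [mul_nonneg h4 h3, mul_nonneg hC h2]

end Laplacian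

lemma rpow_add_le_two_rpow_mul {a b r : ℝ} (ha : 0 ≤ a) (hb : 0 ≤ b) (hr : 1 ≤ r) :
    (a + b) ^ r ≤ 2 ^ (r - 1) * (a ^ r + b ^ r) := by
  lift a to NNReal using ha
  lift b to NNReal using hb
  exact_mod_cast NNReal.rpow_add_le_mul_rpow_add_rpow a b hr

/-- Lemma (nonlinear capacity estimate): for `Φ_R(x) = (1+|x/R|²)^{-q₀/2}` with
`N < q₀ < N + αp`, there is `C > 0` independent of `R` such that
`∫ Φ_R^{-1/(p-1)} |ℒ Φ_R|^{p/(p-1)} ≤ C (R^{-2p/(p-1)+N} + R^{-αp/(p-1)+N})`. -/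
theorem capacity_estimate
    (N : ℕ) (hN : 1 ≤ N) (p : ℝ) (hp : 1 < p) (α : ℝ) (hα : 0 < α) (hα2 : α < 2)
    (q₀ : ℝ) (hq₀1 : (N : ℝ) < q₀) (hq₀2 : q₀ < (N : ℝ) + α * p) :
    ∃ C : ℝ, 0 < C ∧
      ∀ R : ℝ, 0 < R →
        (∫ x : EuclideanSpace ℝ (Fin N),
          ((1 + ‖R⁻¹ • x‖ ^ 2 : ℝ) ^ (-(q₀ / 2))) ^ (-(1 / (p - 1))) *
            |mixedOp N α (fun y => (1 + ‖R⁻¹ • y‖ ^ 2 : ℝ) ^ (-(q₀ / 2))) x| ^ (p / (p - 1))) ≤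
          C * (R ^ (-(2 * p / (p - 1)) + (N : ℝ)) + R ^ (-(α * p / (p - 1)) + (N : ℝ))) := by
  obtain ⟨D, hD, hle⟩ := exists_abs_mixedOp_bracketPow_le hN hα hα2 hq₀1
  have hp1 : 0 < p - 1 := by linarith
  set r := p / (p - 1) with hr
  have hr1 : 1 ≤ r := by rw [hr, one_le_div hp1]; linarith
  set s := (((N : ℝ) + α) * p - q₀) / (p - 1) with hs
  have hsN : (N : ℝ) < s := by rw [hs, lt_div_iff₀ hp1]; nlinarith
  have hinteg := integrable_bracketPow hsN
  set I := ∫ x : EuclideanSpace ℝ (Fin N), bracketPow s x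
  have hI : 0 ≤ I := integral_nonneg fun x => (bracketPow_pos s x).le
  refine ⟨D ^ r * 2 ^ (r - 1) * (I + 1), by positivity, fun R hR => ?_⟩
  set M := D ^ r * (2 ^ (r - 1) * ((R ^ (-2 : ℝ)) ^ r + (R ^ (-α)) ^ r)) with hM
  have hpt : ∀ x : EuclideanSpace ℝ (Fin N),
      ((1 + ‖R⁻¹ • x‖ ^ 2 : ℝ) ^ (-(q₀ / 2))) ^ (-(1 / (p - 1))) *
        |mixedOp N α (fun y => (1 + ‖R⁻¹ • y‖ ^ 2 : ℝ) ^ (-(q₀ / 2))) x| ^ r ≤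
      M * bracketPow s (R⁻¹ • x) := by
    intro x
    have hJ := one_add_norm_sq_pos (R⁻¹ • x)
    have hb := bracketPow_pos ((N : ℝ) + α) (R⁻¹ • x)
    have hpow : |mixedOp N α (fun y => bracketPow q₀ (R⁻¹ • y)) x| ^ r ≤
        M * bracketPow ((N : ℝ) + α) (R⁻¹ • x) ^ r := by
      refine (Real.rpow_le_rpow (abs_nonneg _) (hle R hR x) (by linarith)).trans ?_
      rw [Real.mul_rpow (by positivity) hb.le, Real.mul_rpow hD.le (by positivity), hM]
      gcongr
      exact rpow_add_le_two_rpow_mul (by positivity) (by positivity) hr1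
    calc _ ≤ ((1 + ‖R⁻¹ • x‖ ^ 2 : ℝ) ^ (-(q₀ / 2))) ^ (-(1 / (p - 1))) *
          (M * bracketPow ((N : ℝ) + α) (R⁻¹ • x) ^ r) :=
          mul_le_mul_of_nonneg_left hpow (by positivity)
      _ = M * bracketPow s (R⁻¹ • x) := by
          rw [mul_left_comm, bracketPow, bracketPow, ← Real.rpow_mul hJ.le, ← Real.rpow_mul hJ.le,
            ← Real.rpow_add hJ, hs, hr]
          congr 2
          field_simp
          ring
  have hM0 : 0 ≤ M := by positivity
  calc _ ≤ ∫ x : EuclideanSpace ℝ (Fin N), M * bracketPow s (R⁻¹ • x) :=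
        integral_mono_of_nonneg (Eventually.of_forall fun x => by positivity)
          ((hinteg.comp_smul (inv_ne_zero hR.ne')).const_mul M) (Eventually.of_forall hpt)
    _ = D ^ r * 2 ^ (r - 1) * I * (R ^ (-(2 * p / (p - 1)) + (N : ℝ)) +
          R ^ (-(α * p / (p - 1)) + (N : ℝ))) := by
        rw [integral_const_mul, Measure.integral_comp_inv_smul, finrank_euclideanSpace_fin,
          abs_of_pos (pow_pos hR N), smul_eq_mul, hM, ← Real.rpow_mul hR.le,
          ← Real.rpow_mul hR.le, Real.rpow_add hR, Real.rpow_add hR, Real.rpow_natCast,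
          show -2 * r = -(2 * p / (p - 1)) by rw [hr]; ring,
          show -α * r = -(α * p / (p - 1)) by rw [hr]; ring]
        ring
    _ ≤ _ := by
        gcongr
        linarith

end
end
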